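/- Fix ν > 0 and let f_1(x,t) = exp(i x − ν t). Then for every t > 0 and x ∈ ℝ, −∫_0^t ∫_ℝ G(x − y, ν(t − s)) · f_1(y,s) · ∂_y f_1(y,s) dy ds = (i/(2ν)) · exp(−4νt + 2ix) · (1 − exp(2νt)). That is, the second sequence element of the initial value problem is f_2(x,t) = i exp(−4νt + 2iz)(1 − exp(2νt))/(2ν) with z = x. -/

import Mathlib

open scoped BigOperators

/-- The one-dimensional heat kernel `G(y, τ) = (4πτ)^(−1/2) exp(−y²/(4τ))`. -/
noncomputable def heatKernel (y τ : ℝ) : ℝ :=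
  (Real.sqrt (4 * Real.pi * τ))⁻¹ * Real.exp (-(y ^ 2) / (4 * τ))

/-- The heat kernel acts on the Fourier mode `exp(iky)` by multiplication with `exp(−k²τ)`. -/
theorem integral_heatKernel_mul_cexp {τ : ℝ} (hτ : 0 < τ) (k x : ℝ) :
    ∫ y : ℝ, (heatKernel (x - y) τ : ℂ) * Complex.exp (Complex.I * k * y)
      = Complex.exp (Complex.I * k * x - k ^ 2 * τ) := by
  have hτ' : (τ : ℂ) ≠ 0 := by exact_mod_cast hτ.ne'
  have hb : 0 < (((4 * τ)⁻¹ : ℝ) : ℂ).re := by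
    rw [Complex.ofReal_re]
    positivity
  have hgauss := fourierIntegral_gaussian hb (-k : ℂ)
  have hsqrt : ((Real.pi : ℂ) / (((4 * τ)⁻¹ : ℝ) : ℂ)) ^ (1 / 2 : ℂ)
      = (Real.sqrt (4 * Real.pi * τ) : ℂ) := by
    rw [Real.sqrt_eq_rpow, Complex.ofReal_cpow (by positivity)]
    push_cast
    congr 1
    field_simp
  have hne : (Real.sqrt (4 * Real.pi * τ) : ℂ) ≠ 0 := by
    exact_mod_cast (Real.sqrt_pos.mpr (by positivity)).ne'
  rw [← MeasureTheory.integral_sub_left_eq_self _ MeasureTheory.volume x]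
  have hpoint : ∀ y : ℝ,
      (heatKernel (x - (x - y)) τ : ℂ) * Complex.exp (Complex.I * k * (x - y : ℝ))
        = ((Real.sqrt (4 * Real.pi * τ) : ℂ)⁻¹ * Complex.exp (Complex.I * k * x)) *
          (Complex.exp (Complex.I * (-k) * y) *
            Complex.exp (-(((4 * τ)⁻¹ : ℝ) : ℂ) * y ^ 2)) := by
    intro y
    have hexp : Complex.exp (-(y : ℂ) ^ 2 / (4 * τ)) * Complex.exp (Complex.I * k * (x - y))
        = Complex.exp (Complex.I * k * x) * (Complex.exp (Complex.I * (-k) * y) *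
            Complex.exp (-(4 * (τ : ℂ))⁻¹ * y ^ 2)) := by
      simp only [← Complex.exp_add]
      congr 1
      ring
    rw [sub_sub_cancel, heatKernel]
    push_cast
    linear_combination (Real.sqrt (4 * Real.pi * τ) : ℂ)⁻¹ * hexp
  simp_rw [hpoint]
  rw [MeasureTheory.integral_const_mul, hgauss, hsqrt, mul_mul_mul_comm, inv_mul_cancel₀ hne,
    one_mul, ← Complex.exp_add]
  congr 1
  push_cast
  field_simp
  ring

/-- with `f₁(x,t) = exp(ix − νt)`, the second sequence element of the
initial value problem is
`f₂(x,t) = −∫_0^t ∫_ℝ G(x−y, ν(t−s)) f₁(y,s) ∂_y f₁(y,s) dy ds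
         = (i/(2ν)) exp(−4νt + 2ix) (1 − exp(2νt))`. -/
theorem second_sequence_element
    (ν : ℝ) (hν : 0 < ν)
    (f₁ : ℝ → ℝ → ℂ)
    (hf₁ : ∀ x t : ℝ, f₁ x t = Complex.exp (Complex.I * x - ν * t)) :
    ∀ t : ℝ, 0 < t → ∀ x : ℝ,
      -(∫ s in (0 : ℝ)..t, ∫ y : ℝ,
          (heatKernel (x - y) (ν * (t - s)) : ℂ) *
            (f₁ y s * deriv (fun y' : ℝ => f₁ y' s) y))
        = Complex.I / (2 * ν) * Complex.exp (-(4 * ν * t) + 2 * Complex.I * x) *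
            (1 - Complex.exp (2 * ν * t)) := by
  intro t ht x
  have hν' : (ν : ℂ) ≠ 0 := by exact_mod_cast hν.ne'
  have hderiv : ∀ y s : ℝ, deriv (fun y' : ℝ => f₁ y' s) y
      = Complex.I * Complex.exp (Complex.I * y - ν * s) := by
    intro y s
    simp_rw [hf₁]
    have h : HasDerivAt (fun y' : ℝ => Complex.I * (y' : ℂ) - ν * s) (Complex.I * 1) y :=
      ((Complex.ofRealCLM.hasDerivAt (x := y)).const_mul Complex.I).sub_const _
    rw [h.cexp.deriv]
    ring
  have hinner : ∀ s ∈ Set.Ioo 0 t,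
      ∫ y : ℝ, (heatKernel (x - y) (ν * (t - s)) : ℂ) *
          (f₁ y s * deriv (fun y' : ℝ => f₁ y' s) y)
        = (Complex.I * Complex.exp (-(4 * ν * t) + 2 * Complex.I * x)) *
          Complex.exp (2 * ν * s) := by
    intro s hs
    have hpoint : ∀ y : ℝ, (heatKernel (x - y) (ν * (t - s)) : ℂ) *
          (f₁ y s * deriv (fun y' : ℝ => f₁ y' s) y)
        = (Complex.I * Complex.exp (-(2 * ν * s))) *
          ((heatKernel (x - y) (ν * (t - s)) : ℂ) *
            Complex.exp (Complex.I * (2 : ℝ) * y)) := by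
      intro y
      have hexp : Complex.exp (Complex.I * y - ν * s) * Complex.exp (Complex.I * y - ν * s)
          = Complex.exp (-(2 * ν * s)) * Complex.exp (Complex.I * (2 : ℝ) * y) := by
        simp only [← Complex.exp_add]
        congr 1
        push_cast
        ring
      rw [hderiv, hf₁]
      linear_combination ((heatKernel (x - y) (ν * (t - s)) : ℂ) * Complex.I) * hexp
    simp_rw [hpoint]
    rw [MeasureTheory.integral_const_mul,
      integral_heatKernel_mul_cexp (mul_pos hν (sub_pos.mpr hs.2)),
      mul_assoc Complex.I (Complex.exp _), mul_assoc Complex.I (Complex.exp _),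
      ← Complex.exp_add, ← Complex.exp_add]
    congr 2
    push_cast
    ring
  rw [intervalIntegral.integral_of_le ht.le, MeasureTheory.integral_Ioc_eq_integral_Ioo,
    MeasureTheory.setIntegral_congr_fun measurableSet_Ioo hinner,
    ← MeasureTheory.integral_Ioc_eq_integral_Ioo, ← intervalIntegral.integral_of_le ht.le,
    intervalIntegral.integral_const_mul,
    integral_exp_mul_complex (mul_ne_zero two_ne_zero hν')]
  simp only [Complex.ofReal_zero, mul_zero, Complex.exp_zero]
  field_simp
  ring
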